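/- arXiv:2312.12013 — 4 statements merged into one kernel-verified Lean document; each statement's English description precedes it below -/
import Mathlib

section
/- Let τ > 0 and let U : [0,τ] → ℝ be a non-negative continuous function. Let c₀, c₁ > 0 be constants such that U(t) ≤ c₀ + c₁ ∫_t^τ ( U(s) + ∫_s^τ U(ξ) dξ ) ds for all t ∈ [0,τ]. Then U(t) ≤ c₀ e^{(1+c₁)(τ−t)} for all t ∈ [0,τ]. -/
open MeasureTheory

lemma ContinuousOn.continuousOn_integral_left {a b : ℝ} (hab : a ≤ b) {f : ℝ → ℝ}
    (hf : ContinuousOn f (Set.Icc a b)) :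
    ContinuousOn (fun t => ∫ s in t..b, f s) (Set.Icc a b) := by
  rw [← Set.uIcc_of_le hab] at hf ⊢
  exact intervalIntegral.continuousOn_primitive_interval_left hf.integrableOn_uIcc

lemma ContinuousOn.hasDerivAt_integral_left {a b : ℝ} {f : ℝ → ℝ}
    (hf : ContinuousOn f (Set.Icc a b)) {t : ℝ} (ht : t ∈ Set.Ioo a b) :
    HasDerivAt (fun t => ∫ s in t..b, f s) (-f t) t := by
  refine intervalIntegral.integral_hasDerivAt_left ?_ ?_ ?_
  · exact (hf.mono (Set.Icc_subset_Icc_left ht.1.le)).intervalIntegrable_of_Icc ht.2.le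
  · exact (hf.mono Set.Ioo_subset_Icc_self).stronglyMeasurableAtFilter isOpen_Ioo t ht
  · exact hf.continuousAt (Icc_mem_nhds ht.1 ht.2)

/-- A function satisfying the differential inequality `-k * z ≤ z'` on `[a, b]` is bounded by the
exponential with the same value at `b`. -/
lemma le_mul_exp_of_neg_mul_le_deriv {a b k : ℝ} {z z' : ℝ → ℝ}
    (hz : ContinuousOn z (Set.Icc a b))
    (hz' : ∀ t ∈ Set.Ioo a b, HasDerivAt z (z' t) t)
    (hle : ∀ t ∈ Set.Ioo a b, -k * z t ≤ z' t) {t : ℝ} (ht : t ∈ Set.Icc a b) :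
    z t ≤ z b * Real.exp (k * (b - t)) := by
  have hmono : MonotoneOn (fun x => z x * Real.exp (k * x)) (Set.Icc a b) := by
    refine monotoneOn_of_hasDerivWithinAt_nonneg
      (f' := fun x => z' x * Real.exp (k * x) + z x * (Real.exp (k * x) * (k * 1)))
      (convex_Icc a b) (hz.mul (by fun_prop)) ?_ ?_ <;> rw [interior_Icc]
    · intro x hx
      exact ((hz' x hx).mul ((hasDerivAt_id x).const_mul k).exp).hasDerivWithinAt
    · intro x hx
      have := mul_nonneg (by linarith [hle x hx] : 0 ≤ z' x + k * z x) (Real.exp_pos (k * x)).le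
      linarith
  have hb := hmono ht (Set.right_mem_Icc.2 (ht.1.trans ht.2)) ht.2
  rw [mul_sub, Real.exp_sub, ← mul_div_assoc, le_div_iff₀ (Real.exp_pos _)]
  exact hb

/-- Grönwall-type inequality for iterated integrals on a backward interval. -/
theorem gronwall_iterated_integrals
    (τ : ℝ) (hτ : 0 < τ) (U : ℝ → ℝ)
    (hU_cont : ContinuousOn U (Set.Icc 0 τ))
    (hU_nonneg : ∀ t ∈ Set.Icc (0:ℝ) τ, 0 ≤ U t)
    (c₀ c₁ : ℝ) (hc₀ : 0 < c₀) (hc₁ : 0 < c₁)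
    (h : ∀ t ∈ Set.Icc (0:ℝ) τ,
      U t ≤ c₀ + c₁ * ∫ s in t..τ, (U s + ∫ ξ in s..τ, U ξ)) :
    ∀ t ∈ Set.Icc (0:ℝ) τ, U t ≤ c₀ * Real.exp ((1 + c₁) * (τ - t)) := by
  intro t ht
  set V : ℝ → ℝ := fun t => ∫ ξ in t..τ, U ξ with hV
  set W : ℝ → ℝ := fun t => c₀ + c₁ * ∫ s in t..τ, (U s + V s) with hW
  have hV_nonneg : ∀ t ∈ Set.Icc (0:ℝ) τ, 0 ≤ V t := fun t ht =>
    intervalIntegral.integral_nonneg ht.2 fun s hs => hU_nonneg s ⟨ht.1.trans hs.1, hs.2⟩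
  have hV_cont : ContinuousOn V (Set.Icc 0 τ) := hU_cont.continuousOn_integral_left hτ.le
  have hUV : ContinuousOn (fun s => U s + V s) (Set.Icc 0 τ) := hU_cont.add hV_cont
  have hW_cont : ContinuousOn W (Set.Icc 0 τ) :=
    continuousOn_const.add (continuousOn_const.mul (hUV.continuousOn_integral_left hτ.le))
  have hUW : ∀ t ∈ Set.Icc (0:ℝ) τ, U t ≤ W t := h
  have hbound := le_mul_exp_of_neg_mul_le_deriv (k := 1 + c₁) (z := fun t => W t + V t)
    (z' := fun t => c₁ * -(U t + V t) + -U t) (hW_cont.add hV_cont)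
    (fun s hs => (((hUV.hasDerivAt_integral_left hs).const_mul c₁).const_add c₀).add
      (hU_cont.hasDerivAt_integral_left hs))
    (fun s hs => by
      have hs' := Set.Ioo_subset_Icc_self hs
      have := mul_nonneg (by linarith : 0 ≤ 1 + c₁) (sub_nonneg.2 (hUW s hs'))
      linarith [hV_nonneg s hs']) ht
  have hend : W τ + V τ = c₀ := by simp [hW, hV]
  rw [hend] at hbound
  linarith [hUW t ht, hV_nonneg t ht]
end

section
/- If v ∈ C([0,τ];H), then 𝔗v ∈ C([0,τ];H); that is, the map 𝔗 is well defined from C([0,τ];H) into itself. -/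
open MeasureTheory RealInnerProductSpace

/-- The primitive of a finite-rank exponential kernel applied to an integrable function is
continuous in its lower endpoint. -/
theorem continuousOn_integral_sum_exp_mul_inner_smul {ι H : Type*} [NormedAddCommGroup H]
    [InnerProductSpace ℝ H] {a b : ℝ} (hab : a ≤ b) (J : Finset ι) (φ : ι → H) (lam : ι → ℝ)
    {h : ℝ → H} (hh : IntegrableOn h (Set.Icc a b)) :
    ContinuousOn (fun t => ∫ s in t..b,
      ∑ j ∈ J, (Real.exp (lam j * (s - t)) * ⟪h s, φ j⟫) • φ j) (Set.Icc a b) := by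
  have hint : ∀ j, IntegrableOn (fun s => (Real.exp (lam j * s) * ⟪h s, φ j⟫) • φ j)
      (Set.Icc a b) := fun j => by
    have h₁ : IntegrableOn (fun s => ⟪h s, φ j⟫) (Set.Icc a b) := Integrable.inner_const hh (φ j)
    have h₂ : IntegrableOn (fun s => Real.exp (lam j * s) * ⟪h s, φ j⟫) (Set.Icc a b) :=
      h₁.continuousOn_mul (by fun_prop) isCompact_Icc
    exact Integrable.smul_const h₂ (φ j)
  have hcont : ContinuousOn (fun t => ∑ j ∈ J, Real.exp (-(lam j * t)) •
      ∫ s in t..b, (Real.exp (lam j * s) * ⟪h s, φ j⟫) • φ j) (Set.Icc a b) := by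
    refine continuousOn_finsetSum _ fun j _ => ContinuousOn.smul (by fun_prop) ?_
    have := intervalIntegral.continuousOn_primitive_interval_left (μ := volume)
      (a := a) (b := b) (by rw [Set.uIcc_of_le hab]; exact hint j)
    rwa [Set.uIcc_of_le hab] at this
  refine hcont.congr fun t ht => ?_
  have hterm : ∀ s, ∑ j ∈ J, (Real.exp (lam j * (s - t)) * ⟪h s, φ j⟫) • φ j =
      ∑ j ∈ J, Real.exp (-(lam j * t)) • (Real.exp (lam j * s) * ⟪h s, φ j⟫) • φ j := fun s => by
    refine Finset.sum_congr rfl fun j _ => ?_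
    rw [smul_smul, ← mul_assoc, ← Real.exp_add]
    ring_nf
  simp only [hterm]
  rw [intervalIntegral.integral_finsetSum fun j _ => ?_]
  · simp only [intervalIntegral.integral_smul]
  · refine IntervalIntegrable.smul ?_ _
    rw [intervalIntegrable_iff_integrableOn_Icc_of_le ht.2]
    exact (hint j).mono_set (Set.Icc_subset_Icc_left ht.1)

/-- If `v ∈ C([0,τ];H)` then `𝔗v ∈ C([0,τ];H)`: the map `𝔗` is well defined from
`C([0,τ];H)` into itself. -/
theorem T_well_defined
    {H : Type*} [NormedAddCommGroup H] [InnerProductSpace ℝ H] [CompleteSpace H]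
    (τ : ℝ) (hτ : 0 < τ) (N : ℕ) (hN : 1 ≤ N)
    (φ : ℕ → H)
    (hφ : ∀ i ∈ Finset.Icc 1 N, ∀ j ∈ Finset.Icc 1 N,
      ⟪φ i, φ j⟫ = if i = j then (1:ℝ) else 0)
    (lam : ℕ → ℝ) (hlam_pos : 0 < lam 1)
    (hlam_mono : ∀ i j, 1 ≤ i → i ≤ j → j ≤ N → lam i ≤ lam j)
    (F : ℝ → H → H) (κ : ℝ) (hκ : 0 < κ)
    (hF_lip : ∀ s ∈ Set.Icc (0:ℝ) τ, ∀ ψ₁ ψ₂ : H, ‖F s ψ₁ - F s ψ₂‖ ≤ κ * ‖ψ₁ - ψ₂‖)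
    (hF_int : ∃ φ₀ : H, IntegrableOn (fun s => F s φ₀) (Set.Icc 0 τ))
    (hF_meas : ∀ w : ℝ → H, AEStronglyMeasurable w (volume.restrict (Set.Icc 0 τ)) →
      AEStronglyMeasurable (fun s => F s (w s)) (volume.restrict (Set.Icc 0 τ)))
    (g : H)
    (T : (ℝ → H) → (ℝ → H))
    (hT : ∀ (w : ℝ → H) (t : ℝ), T w t =
      (∑ j ∈ Finset.Icc 1 N, (Real.exp (lam j * (τ - t)) * ⟪g, φ j⟫) • φ j)
      - (∫ s in t..τ, ∑ j ∈ Finset.Icc 1 N, (Real.exp (lam j * (s - t)) * ⟪F s (w s), φ j⟫) • φ j)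
      - (∫ s in t..τ, ∑ j ∈ Finset.Icc 1 N,
          (Real.exp (lam j * (s - t)) * ⟪(∫ ξ in s..τ, w ξ), φ j⟫) • φ j))
    (v : ℝ → H) (hv : ContinuousOn v (Set.Icc 0 τ)) :
    ContinuousOn (T v) (Set.Icc 0 τ) := by
  have hvint : IntegrableOn v (Set.Icc 0 τ) := hv.integrableOn_Icc
  have hFv : IntegrableOn (fun s => F s (v s)) (Set.Icc 0 τ) := by
    obtain ⟨φ₀, hφ₀⟩ := hF_int
    have hbound : IntegrableOn (fun s => κ * ‖v s - φ₀‖) (Set.Icc 0 τ) :=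
      ContinuousOn.integrableOn_Icc (by fun_prop)
    have hdiff : IntegrableOn (fun s => F s (v s) - F s φ₀) (Set.Icc 0 τ) :=
      Integrable.mono' hbound ((hF_meas v hvint.aestronglyMeasurable).sub hφ₀.aestronglyMeasurable)
        ((ae_restrict_mem measurableSet_Icc).mono fun s hs => hF_lip s hs _ _)
    exact (Integrable.add hdiff hφ₀).congr (.of_forall fun s => sub_add_cancel _ _)
  have hprim : IntegrableOn (fun s => ∫ ξ in s..τ, v ξ) (Set.Icc 0 τ) := by
    refine ContinuousOn.integrableOn_Icc ?_
    have := intervalIntegral.continuousOn_primitive_interval_left (μ := volume)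
      (a := 0) (b := τ) (by rw [Set.uIcc_of_le hτ.le]; exact hvint)
    rwa [Set.uIcc_of_le hτ.le] at this
  rw [funext (hT v)]
  refine ContinuousOn.sub (ContinuousOn.sub (by fun_prop) ?_) ?_
  · exact continuousOn_integral_sum_exp_mul_inner_smul hτ.le _ φ lam hFv
  · exact continuousOn_integral_sum_exp_mul_inner_smul hτ.le _ φ lam hprim
end

section
/- There exists a unique v₀ ∈ C([0,τ];H) such that 𝔗v₀ = v₀. -/
open MeasureTheory RealInnerProductSpace

open Set Filter Topology

section WeightedContraction

variable {E : Type*} [NormedAddCommGroup E]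

/-- A self-map of `C([a,b]; E)` that is a contraction for the weighted sup distance
`sup ‖v s - w s‖ / p s` has a unique fixed point. -/
theorem exists_unique_fixedPoint_of_weighted_contraction [NormedSpace ℝ E] [CompleteSpace E]
    {a b : ℝ} (hab : a ≤ b) {p : ℝ → ℝ} (hp : Continuous p) (hp_pos : ∀ s, 0 < p s)
    {K : ℝ} (hK₀ : 0 ≤ K) (hK : K < 1) {T : (ℝ → E) → ℝ → E}
    (hT_cont : ∀ v, ContinuousOn v (Icc a b) → ContinuousOn (T v) (Icc a b))
    (hT_contr : ∀ v w, ContinuousOn v (Icc a b) → ContinuousOn w (Icc a b) → ∀ D, 0 ≤ D →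
      (∀ s ∈ Icc a b, ‖v s - w s‖ ≤ D * p s) →
      ∀ t ∈ Icc a b, ‖T v t - T w t‖ ≤ K * D * p t) :
    ∃ v₀ : ℝ → E,
      (ContinuousOn v₀ (Icc a b) ∧ ∀ t ∈ Icc a b, T v₀ t = v₀ t) ∧
      ∀ w : ℝ → E, ContinuousOn w (Icc a b) → (∀ t ∈ Icc a b, T w t = w t) →
        ∀ t ∈ Icc a b, w t = v₀ t := by
  set ext : C(Icc a b, E) → ℝ → E := fun u s ↦ p s • IccExtend hab u s
  have hext_cont (u : C(Icc a b, E)) : ContinuousOn (ext u) (Icc a b) :=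
    (hp.smul u.continuous.Icc_extend').continuousOn
  set Φ : C(Icc a b, E) → C(Icc a b, E) := fun u ↦
    ⟨fun t ↦ (p t)⁻¹ • T (ext u) t,
      ((hp.inv₀ fun t ↦ (hp_pos t).ne').comp continuous_subtype_val).smul
        (hT_cont _ (hext_cont u)).domRestrict⟩
  have hΦ : ContractingWith ⟨K, hK₀⟩ Φ := by
    refine ⟨by exact_mod_cast hK, LipschitzWith.of_dist_le_mul fun u u' ↦ ?_⟩
    refine (ContinuousMap.dist_le (by positivity)).2 fun t ↦ ?_
    have key := hT_contr (ext u) (ext u') (hext_cont u) (hext_cont u') (dist u u') dist_nonneg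
      (fun s hs ↦ by
        have h := ContinuousMap.dist_apply_le_dist (f := u) (g := u') ⟨s, hs⟩
        rw [dist_eq_norm] at h
        simp only [ext, IccExtend_of_mem hab _ hs]
        rw [← smul_sub, norm_smul, Real.norm_of_nonneg (hp_pos s).le, mul_comm]
        exact mul_le_mul_of_nonneg_right h (hp_pos s).le) t t.2
    have ht := hp_pos t
    simp only [Φ, ContinuousMap.coe_mk]
    rw [dist_eq_norm, ← smul_sub, norm_smul, norm_inv, Real.norm_of_nonneg ht.le,
      inv_mul_le_iff₀ ht, mul_comm]
    exact key
  obtain ⟨u, hu⟩ : ∃ u, Φ u = u := ⟨_, hΦ.fixedPoint_isFixedPt⟩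
  have hfix : ∀ t ∈ Icc a b, T (ext u) t = ext u t := fun t ht ↦ by
    have h : (p t)⁻¹ • T (ext u) t = u ⟨t, ht⟩ := DFunLike.congr_fun hu ⟨t, ht⟩
    simp only [ext, IccExtend_of_mem hab _ ht] at h ⊢
    rw [← h, smul_inv_smul₀ (hp_pos t).ne']
  refine ⟨ext u, ⟨hext_cont u, hfix⟩, fun w hw hTw t ht ↦ ?_⟩
  obtain ⟨C, hC⟩ := isCompact_Icc.exists_bound_of_continuousOn
    (((hw.sub (hext_cont u)).norm).div hp.continuousOn fun s _ ↦ (hp_pos s).ne')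
  have hbound (n : ℕ) : ∀ s ∈ Icc a b, ‖w s - ext u s‖ ≤ K ^ n * |C| * p s := by
    induction n with
    | zero =>
      intro s hs
      have h := (le_abs_self _).trans ((hC s hs).trans (le_abs_self C))
      simpa [div_le_iff₀ (hp_pos s)] using h
    | succ n ih =>
      intro s hs
      rw [← hTw s hs, ← hfix s hs, pow_succ', mul_assoc K]
      exact hT_contr _ _ hw (hext_cont u) _ (by positivity) ih s hs
  have hlim : Tendsto (fun n : ℕ ↦ K ^ n * |C| * p t) atTop (𝓝 0) := by
    simpa using ((tendsto_pow_atTop_nhds_zero_of_lt_one hK₀ hK).mul_const |C|).mul_const (p t)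
  have := ge_of_tendsto' hlim fun n ↦ hbound n t ht
  exact sub_eq_zero.1 (norm_le_zero_iff.1 this)

end WeightedContraction

section BackwardConvolution

variable {E : Type*} [NormedAddCommGroup E] [NormedSpace ℝ E] {S : ℝ → E →L[ℝ] E} {τ C : ℝ}
  {h h₁ h₂ : ℝ → E}

theorem integrableOn_backward_kernel_apply (hS : Continuous S)
    (hC : ∀ r ∈ Icc 0 τ, ‖S r‖ ≤ C) (hh : IntegrableOn h (Icc 0 τ)) {t : ℝ} (ht : 0 ≤ t) :
    IntegrableOn (fun s ↦ S (s - t) (h s)) (Ioc t τ) := by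
  have hh' : IntegrableOn h (Ioc t τ) :=
    hh.mono_set fun s hs ↦ ⟨ht.trans hs.1.le, hs.2⟩
  refine (hh'.norm.const_mul C).mono' ?_ ?_
  · exact (ContinuousLinearMap.id ℝ (E →L[ℝ] E)).aestronglyMeasurable_comp₂
      (hS.comp (continuous_id.sub continuous_const)).aestronglyMeasurable hh'.aestronglyMeasurable
  · filter_upwards [ae_restrict_mem measurableSet_Ioc] with s hs
    exact (S (s - t)).le_of_opNorm_le (hC _ ⟨by linarith [hs.1], by linarith [hs.2]⟩) _

theorem continuousOn_backward_convolution (hS : Continuous S)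
    (hC : ∀ r ∈ Icc 0 τ, ‖S r‖ ≤ C) (hh : IntegrableOn h (Icc 0 τ)) :
    ContinuousOn (fun t ↦ ∫ s in t..τ, S (s - t) (h s)) (Icc 0 τ) := by
  have hsets {t : ℝ} (ht : 0 ≤ t) : Ioc 0 τ ∩ Ioi t = Ioc t τ := by
    ext s
    simp only [mem_inter_iff, mem_Ioc, mem_Ioi]
    constructor
    · rintro ⟨⟨_, h₂⟩, h₃⟩
      exact ⟨h₃, h₂⟩
    · rintro ⟨h₁, h₂⟩
      exact ⟨⟨ht.trans_lt h₁, h₂⟩, h₁⟩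
  have heq : ∀ t ∈ Icc 0 τ, ∫ s in t..τ, S (s - t) (h s) =
      ∫ s in Ioc 0 τ, (Ioi t).indicator (fun s ↦ S (s - t) (h s)) s := fun t ht ↦ by
    rw [setIntegral_indicator measurableSet_Ioi, hsets ht.1,
      intervalIntegral.integral_of_le ht.2]
  refine ContinuousOn.congr (fun t₀ ht₀ ↦ ?_) heq
  refine continuousWithinAt_of_dominated (bound := fun s ↦ C * ‖h s‖) ?_ ?_
    ((hh.mono_set Ioc_subset_Icc_self).norm.const_mul C) ?_
  · filter_upwards [self_mem_nhdsWithin] with t ht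
    rw [aestronglyMeasurable_indicator_iff measurableSet_Ioi,
      Measure.restrict_restrict measurableSet_Ioi, inter_comm, hsets ht.1]
    exact (integrableOn_backward_kernel_apply hS hC hh ht.1).aestronglyMeasurable
  · filter_upwards [self_mem_nhdsWithin] with t ht
    filter_upwards [ae_restrict_mem measurableSet_Ioc] with s hs
    by_cases hst : t < s
    · rw [indicator_of_mem (mem_Ioi.2 hst)]
      exact (S (s - t)).le_of_opNorm_le (hC _ ⟨by linarith, by linarith [hs.2, ht.1]⟩) _
    · rw [indicator_of_notMem (by simpa using hst), norm_zero]
      have : 0 ≤ C := (norm_nonneg _).trans (hC 0 ⟨le_rfl, ht.1.trans ht.2⟩)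
      positivity
  · have hne : ∀ᵐ s ∂volume.restrict (Ioc 0 τ), s ≠ t₀ :=
      ae_restrict_of_ae (Measure.ae_ne volume t₀)
    filter_upwards [hne] with s hs
    refine ContinuousAt.continuousWithinAt ?_
    rcases hs.lt_or_gt with hlt | hgt
    · refine (continuousAt_const (y := (0 : E))).congr ?_
      filter_upwards [lt_mem_nhds hlt] with t ht
      rw [indicator_of_notMem (by simpa using ht.le)]
    · have hcont : ContinuousAt (fun t ↦ S (s - t) (h s)) t₀ := by fun_prop
      refine hcont.congr ?_
      filter_upwards [gt_mem_nhds hgt] with t ht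
      rw [indicator_of_mem (mem_Ioi.2 ht)]

theorem norm_backward_convolution_sub_le (hS : Continuous S)
    (hC : ∀ r ∈ Icc 0 τ, ‖S r‖ ≤ C)
    (hh₁ : IntegrableOn h₁ (Icc 0 τ)) (hh₂ : IntegrableOn h₂ (Icc 0 τ))
    {M ρ : ℝ} (hM : 0 ≤ M) (hρ : 0 < ρ)
    (hle : ∀ s ∈ Icc 0 τ, ‖h₁ s - h₂ s‖ ≤ M * Real.exp (ρ * (τ - s)))
    {t : ℝ} (ht : t ∈ Icc 0 τ) :
    ‖(∫ s in t..τ, S (s - t) (h₁ s)) - ∫ s in t..τ, S (s - t) (h₂ s)‖ ≤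
      C * M / ρ * Real.exp (ρ * (τ - t)) := by
  have hC₀ : 0 ≤ C := (norm_nonneg _).trans (hC 0 ⟨le_rfl, ht.1.trans ht.2⟩)
  have hexp : ∫ s in t..τ, C * (M * Real.exp (ρ * (τ - s))) =
      C * M / ρ * (Real.exp (ρ * (τ - t)) - 1) := by
    rw [intervalIntegral.integral_eq_sub_of_hasDerivAt
      (f := fun s ↦ -(C * M / ρ * Real.exp (ρ * (τ - s)))) _
      (by apply Continuous.intervalIntegrable; fun_prop)]
    · simp only [sub_self, mul_zero, Real.exp_zero]
      ring
    · intro s _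
      refine (((((hasDerivAt_id' s).const_sub τ).const_mul ρ).exp.const_mul
        (C * M / ρ)).fun_neg).congr_deriv ?_
      field_simp
  rw [← intervalIntegral.integral_sub
    ((intervalIntegrable_iff_integrableOn_Ioc_of_le ht.2).2
      (integrableOn_backward_kernel_apply hS hC hh₁ ht.1))
    ((intervalIntegrable_iff_integrableOn_Ioc_of_le ht.2).2
      (integrableOn_backward_kernel_apply hS hC hh₂ ht.1))]
  calc _ ≤ ∫ s in t..τ, C * (M * Real.exp (ρ * (τ - s))) := by
        refine intervalIntegral.norm_integral_le_of_norm_le ht.2 (ae_of_all _ fun s hs ↦ ?_)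
          (by apply Continuous.intervalIntegrable; fun_prop)
        rw [← map_sub]
        refine (S (s - t)).le_of_opNorm_le_of_le
          (hC _ ⟨by linarith [hs.1], by linarith [hs.2, ht.1]⟩)
          (hle s ⟨ht.1.trans hs.1.le, hs.2⟩)
    _ = C * M / ρ * (Real.exp (ρ * (τ - t)) - 1) := hexp
    _ ≤ C * M / ρ * Real.exp (ρ * (τ - t)) := by gcongr; linarith

end BackwardConvolution

theorem norm_integral_sub_le_of_le_exp {E : Type*} [NormedAddCommGroup E] [NormedSpace ℝ E]
    {τ D ρ : ℝ} {v w : ℝ → E} (hv : ContinuousOn v (Icc 0 τ)) (hw : ContinuousOn w (Icc 0 τ))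
    (hD : 0 ≤ D) (hρ : 0 < ρ)
    (hle : ∀ s ∈ Icc 0 τ, ‖v s - w s‖ ≤ D * Real.exp (ρ * (τ - s)))
    {s : ℝ} (hs : s ∈ Icc 0 τ) :
    ‖(∫ ξ in s..τ, v ξ) - ∫ ξ in s..τ, w ξ‖ ≤ τ * D * Real.exp (ρ * (τ - s)) := by
  have hsub : uIcc s τ ⊆ Icc 0 τ := by
    rw [uIcc_of_le hs.2]
    exact Icc_subset_Icc_left hs.1
  rw [← intervalIntegral.integral_sub (hv.mono hsub).intervalIntegrable
    (hw.mono hsub).intervalIntegrable]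
  calc _ ≤ D * Real.exp (ρ * (τ - s)) * |τ - s| := by
        refine intervalIntegral.norm_integral_le_of_norm_le_const fun ξ hξ ↦ ?_
        rw [uIoc_of_le hs.2] at hξ
        refine (hle ξ ⟨hs.1.trans hξ.1.le, hξ.2⟩).trans ?_
        gcongr
        exact hξ.1.le
    _ ≤ D * Real.exp (ρ * (τ - s)) * τ := by
        rw [abs_of_nonneg (sub_nonneg.2 hs.2)]
        gcongr
        linarith [hs.1]
    _ = τ * D * Real.exp (ρ * (τ - s)) := by ring

theorem integrableOn_superposition_of_lipschitz {E : Type*} [NormedAddCommGroup E]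
    {τ κ : ℝ} {F : ℝ → E → E}
    (hF_lip : ∀ s ∈ Icc (0 : ℝ) τ, ∀ ψ₁ ψ₂ : E, ‖F s ψ₁ - F s ψ₂‖ ≤ κ * ‖ψ₁ - ψ₂‖)
    {φ₀ : E} (hF_int : IntegrableOn (fun s ↦ F s φ₀) (Icc 0 τ))
    {v : ℝ → E} (hv : ContinuousOn v (Icc 0 τ))
    (hF_meas : AEStronglyMeasurable (fun s ↦ F s (v s)) (volume.restrict (Icc 0 τ))) :
    IntegrableOn (fun s ↦ F s (v s)) (Icc 0 τ) := by
  have hdiff : IntegrableOn (fun s ↦ v s - φ₀) (Icc 0 τ) :=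
    (hv.sub continuousOn_const).integrableOn_Icc
  refine (hF_int.norm.add (hdiff.norm.const_mul κ)).mono' hF_meas ?_
  filter_upwards [ae_restrict_mem measurableSet_Icc] with s hs
  have := norm_add_le (F s φ₀) (F s (v s) - F s φ₀)
  rw [add_sub_cancel] at this
  exact this.trans (by simpa using hF_lip s hs (v s) φ₀)

/-- The operator `ψ ↦ ∑ e^{λ_j t} ⟨ψ, φ_j⟩ φ_j`, summed over `1 ≤ j ≤ N`. -/
noncomputable def truncatedExpOperator {H : Type*} [NormedAddCommGroup H] [InnerProductSpace ℝ H]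
    (N : ℕ) (φ : ℕ → H) (lam : ℕ → ℝ) (t : ℝ) : H →L[ℝ] H :=
  ∑ j ∈ Finset.Icc 1 N, Real.exp (lam j * t) • (innerSL ℝ (φ j)).smulRight (φ j)

section TruncatedExpOperator

variable {H : Type*} [NormedAddCommGroup H] [InnerProductSpace ℝ H]
  (N : ℕ) (φ : ℕ → H) (lam : ℕ → ℝ)

theorem truncatedExpOperator_apply (t : ℝ) (ψ : H) :
    truncatedExpOperator N φ lam t ψ =
      ∑ j ∈ Finset.Icc 1 N, (Real.exp (lam j * t) * ⟪ψ, φ j⟫) • φ j := by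
  simp [truncatedExpOperator, mul_smul, real_inner_comm]

theorem continuous_truncatedExpOperator : Continuous (truncatedExpOperator N φ lam) := by
  unfold truncatedExpOperator
  fun_prop

end TruncatedExpOperator

/-- There exists a unique `v₀ ∈ C([0,τ];H)` such that `𝔗v₀ = v₀`. -/
theorem T_unique_fixed_point
    {H : Type*} [NormedAddCommGroup H] [InnerProductSpace ℝ H] [CompleteSpace H]
    (τ : ℝ) (hτ : 0 < τ) (N : ℕ) (hN : 1 ≤ N)
    (φ : ℕ → H)
    (hφ : ∀ i ∈ Finset.Icc 1 N, ∀ j ∈ Finset.Icc 1 N,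
      ⟪φ i, φ j⟫ = if i = j then (1:ℝ) else 0)
    (lam : ℕ → ℝ) (hlam_pos : 0 < lam 1)
    (hlam_mono : ∀ i j, 1 ≤ i → i ≤ j → j ≤ N → lam i ≤ lam j)
    (F : ℝ → H → H) (κ : ℝ) (hκ : 0 < κ)
    (hF_lip : ∀ s ∈ Set.Icc (0:ℝ) τ, ∀ ψ₁ ψ₂ : H, ‖F s ψ₁ - F s ψ₂‖ ≤ κ * ‖ψ₁ - ψ₂‖)
    (hF_int : ∃ φ₀ : H, IntegrableOn (fun s => F s φ₀) (Set.Icc 0 τ))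
    (hF_meas : ∀ w : ℝ → H, AEStronglyMeasurable w (volume.restrict (Set.Icc 0 τ)) →
      AEStronglyMeasurable (fun s => F s (w s)) (volume.restrict (Set.Icc 0 τ)))
    (g : H)
    (T : (ℝ → H) → (ℝ → H))
    (hT : ∀ (w : ℝ → H) (t : ℝ), T w t =
      (∑ j ∈ Finset.Icc 1 N, (Real.exp (lam j * (τ - t)) * ⟪g, φ j⟫) • φ j)
      - (∫ s in t..τ, ∑ j ∈ Finset.Icc 1 N, (Real.exp (lam j * (s - t)) * ⟪F s (w s), φ j⟫) • φ j)
      - (∫ s in t..τ, ∑ j ∈ Finset.Icc 1 N,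
          (Real.exp (lam j * (s - t)) * ⟪(∫ ξ in s..τ, w ξ), φ j⟫) • φ j)) :
    ∃ v₀ : ℝ → H,
      (ContinuousOn v₀ (Set.Icc 0 τ) ∧ ∀ t ∈ Set.Icc (0:ℝ) τ, T v₀ t = v₀ t) ∧
      ∀ w : ℝ → H, ContinuousOn w (Set.Icc 0 τ) → (∀ t ∈ Set.Icc (0:ℝ) τ, T w t = w t) →
        ∀ t ∈ Set.Icc (0:ℝ) τ, w t = v₀ t := by
  simp only [← truncatedExpOperator_apply] at hT
  set S := truncatedExpOperator N φ lam
  have hS : Continuous S := continuous_truncatedExpOperator N φ lam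
  obtain ⟨C, hC⟩ := isCompact_Icc.exists_bound_of_continuousOn (hS.continuousOn (s := Icc 0 τ))
  have hC₀ : 0 ≤ C := (norm_nonneg _).trans (hC 0 ⟨le_rfl, hτ.le⟩)
  obtain ⟨φ₀, hφ₀⟩ := hF_int
  have hF_comp (v : ℝ → H) (hv : ContinuousOn v (Icc 0 τ)) :
      IntegrableOn (fun s ↦ F s (v s)) (Icc 0 τ) :=
    integrableOn_superposition_of_lipschitz hF_lip hφ₀ hv
      (hF_meas v (hv.aestronglyMeasurable measurableSet_Icc))
  have hprim (v : ℝ → H) (hv : ContinuousOn v (Icc 0 τ)) :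
      IntegrableOn (fun s ↦ ∫ ξ in s..τ, v ξ) (Icc 0 τ) := by
    have := intervalIntegral.continuousOn_primitive_interval_left (μ := volume) (f := v)
      (a := 0) (b := τ) (by rw [uIcc_of_le hτ.le]; exact hv.integrableOn_Icc)
    rw [uIcc_of_le hτ.le] at this
    exact this.integrableOn_Icc
  set ρ : ℝ := 2 * C * (κ + τ) + 1
  have hρ : 0 < ρ := by positivity
  refine exists_unique_fixedPoint_of_weighted_contraction hτ.le
    (p := fun s ↦ Real.exp (ρ * (τ - s))) (by fun_prop) (fun s ↦ Real.exp_pos _)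
    (K := C * (κ + τ) / ρ) (by positivity) ?_ ?_ ?_
  · rw [div_lt_one hρ]
    have : 0 ≤ C * (κ + τ) := by positivity
    linarith
  · intro v hv
    refine ContinuousOn.congr ?_ fun t _ ↦ hT v t
    refine (ContinuousOn.sub ?_ (continuousOn_backward_convolution hS hC (hF_comp v hv))).sub
      (continuousOn_backward_convolution hS hC (hprim v hv))
    fun_prop
  · intro v w hv hw D hD hle t ht
    have hF_le := norm_backward_convolution_sub_le hS hC (hF_comp v hv) (hF_comp w hw)
      (M := κ * D) (by positivity) hρ (fun s hs ↦ by
        refine (hF_lip s hs _ _).trans ?_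
        rw [mul_assoc]
        exact mul_le_mul_of_nonneg_left (hle s hs) hκ.le) ht
    have hprim_le := norm_backward_convolution_sub_le hS hC (hprim v hv) (hprim w hw)
      (M := τ * D) (by positivity) hρ
      (fun s hs ↦ norm_integral_sub_le_of_le_exp hv hw hD hρ hle hs) ht
    rw [hT, hT, ← norm_neg]
    refine (congrArg norm (by abel)).trans_le ((norm_add_le_of_le hF_le hprim_le).trans_eq ?_)
    ring
end

section
/- Let κ₀ = max{κ,1} and δ > 0. Let g, g^δ ∈ H with ‖g − g^δ‖ ≤ δ, let u^N be the unique fixed point in C([0,τ];H) of 𝔗 with data g, and let u^N_δ be the unique fixed point of the analogous map 𝔗_δ in which g is replaced by g^δ. Then for every t ∈ [0,τ], ‖u^N(t) − u^N_δ(t)‖ ≤ δ e^{λ_N(τ−t)} e^{(1+κ₀)(τ−t)}. -/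
open MeasureTheory RealInnerProductSpace

section TruncatedSemigroup

variable {H : Type*} [NormedAddCommGroup H] [InnerProductSpace ℝ H]

/-- A diagonal operator with entries bounded by `C` on an orthonormal family is bounded by `C`. -/
theorem Orthonormal.norm_sum_mul_inner_smul_le {ι : Type*} [Fintype ι] {e : ι → H}
    (he : Orthonormal ℝ e) {a : ι → ℝ} {C : ℝ} (hC : 0 ≤ C) (ha : ∀ i, |a i| ≤ C) (v : H) :
    ‖∑ i, (a i * ⟪v, e i⟫) • e i‖ ≤ C * ‖v‖ := by
  refine abs_le_of_sq_le_sq' ?_ (by positivity) |>.2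
  rw [← real_inner_self_eq_norm_sq, he.inner_sum, mul_pow]
  have bessel : ∑ i, ⟪v, e i⟫ ^ 2 ≤ ‖v‖ ^ 2 := by
    simpa [real_inner_comm] using he.sum_inner_products_le v (s := Finset.univ)
  calc ∑ i, (starRingEnd ℝ) (a i * ⟪v, e i⟫) * (a i * ⟪v, e i⟫)
      ≤ ∑ i, C ^ 2 * ⟪v, e i⟫ ^ 2 := by
        refine Finset.sum_le_sum fun i _ => ?_
        have := sq_le_sq' (abs_le.1 (ha i)).1 (abs_le.1 (ha i)).2
        simp only [conj_trivial]
        nlinarith [mul_le_mul_of_nonneg_right this (sq_nonneg ⟪v, e i⟫)]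
    _ = C ^ 2 * ∑ i, ⟪v, e i⟫ ^ 2 := by rw [Finset.mul_sum]
    _ ≤ C ^ 2 * ‖v‖ ^ 2 := by gcongr

/-- The truncated operator `S_N(r)`, with `S_N(r) v = ∑ j ∈ {1, …, N}, e^{λ_j r} ⟪v, φ_j⟫ φ_j`. -/
noncomputable def truncatedSemigroup (φ : ℕ → H) (lam : ℕ → ℝ) (N : ℕ) (r : ℝ) (v : H) : H :=
  ∑ j ∈ Finset.Icc 1 N, (Real.exp (lam j * r) * ⟪v, φ j⟫) • φ j

namespace truncatedSemigroup

variable {φ : ℕ → H} {lam : ℕ → ℝ} {N : ℕ}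

theorem map_add (r : ℝ) (v w : H) : truncatedSemigroup φ lam N r (v + w) =
    truncatedSemigroup φ lam N r v + truncatedSemigroup φ lam N r w := by
  simp only [truncatedSemigroup, inner_add_left, mul_add, add_smul, Finset.sum_add_distrib]

theorem map_sub (r : ℝ) (v w : H) : truncatedSemigroup φ lam N r (v - w) =
    truncatedSemigroup φ lam N r v - truncatedSemigroup φ lam N r w := by
  simp only [truncatedSemigroup, inner_sub_left, mul_sub, sub_smul, Finset.sum_sub_distrib]

theorem norm_le
    (hφ : ∀ i ∈ Finset.Icc 1 N, ∀ j ∈ Finset.Icc 1 N, ⟪φ i, φ j⟫ = if i = j then (1:ℝ) else 0)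
    (hlam : ∀ j ∈ Finset.Icc 1 N, lam j ≤ lam N) {r : ℝ} (hr : 0 ≤ r) (v : H) :
    ‖truncatedSemigroup φ lam N r v‖ ≤ Real.exp (lam N * r) * ‖v‖ := by
  have he : Orthonormal ℝ fun i : Finset.Icc 1 N => φ i := by
    rw [orthonormal_iff_ite]
    intro i j
    simp only [hφ i i.2 j j.2, Subtype.ext_iff]
  rw [truncatedSemigroup, ← Finset.sum_coe_sort]
  refine he.norm_sum_mul_inner_smul_le (a := fun i => Real.exp (lam i * r))
    (Real.exp_pos _).le (fun i => ?_) v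
  rw [abs_of_pos (Real.exp_pos _)]
  have := hlam i i.2
  gcongr

theorem intervalIntegrable {f : ℝ → H} {a b : ℝ}
    (hf : IntervalIntegrable f volume a b) (t : ℝ) :
    IntervalIntegrable (fun s => truncatedSemigroup φ lam N (s - t) (f s)) volume a b := by
  have h : ∀ j ∈ Finset.Icc 1 N, IntervalIntegrable
      (fun s => (Real.exp (lam j * (s - t)) * ⟪f s, φ j⟫) • φ j) volume a b := by
    intro j _
    have hin : IntervalIntegrable (fun s => ⟪f s, φ j⟫) volume a b :=
      ⟨hf.1.inner_const (φ j), hf.2.inner_const (φ j)⟩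
    have hm := hin.continuousOn_mul
      (g := fun s => Real.exp (lam j * (s - t))) (by fun_prop)
    exact ⟨hm.1.smul_const _, hm.2.smul_const _⟩
  exact (IntervalIntegrable.sum _ h).congr fun s _ => by
    simp [truncatedSemigroup]

end truncatedSemigroup

end TruncatedSemigroup

/-- A nonlinearity which is Lipschitz in the state and integrable at one state is integrable
along continuous curves. -/
theorem integrableOn_comp_of_lipschitz {H : Type*} [NormedAddCommGroup H]
    {τ κ : ℝ} {F : ℝ → H → H}
    (hF_lip : ∀ s ∈ Set.Icc (0:ℝ) τ, ∀ ψ₁ ψ₂ : H, ‖F s ψ₁ - F s ψ₂‖ ≤ κ * ‖ψ₁ - ψ₂‖)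
    (hF_int : ∃ φ₀ : H, IntegrableOn (fun s => F s φ₀) (Set.Icc 0 τ))
    (hF_meas : ∀ w : ℝ → H, AEStronglyMeasurable w (volume.restrict (Set.Icc 0 τ)) →
      AEStronglyMeasurable (fun s => F s (w s)) (volume.restrict (Set.Icc 0 τ)))
    {u : ℝ → H} (hu : ContinuousOn u (Set.Icc 0 τ)) :
    IntegrableOn (fun s => F s (u s)) (Set.Icc 0 τ) := by
  obtain ⟨φ₀, h₀⟩ := hF_int
  have hdom : IntegrableOn (fun s => κ * ‖u s - φ₀‖) (Set.Icc 0 τ) :=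
    (continuousOn_const.mul (hu.sub continuousOn_const).norm).integrableOn_Icc
  have hdiff : IntegrableOn (fun s => F s (u s) - F s φ₀) (Set.Icc 0 τ) := by
    refine Integrable.mono' hdom ((hF_meas u ?_).sub h₀.aestronglyMeasurable) ?_
    · exact hu.integrableOn_Icc.aestronglyMeasurable
    · exact (ae_restrict_mem measurableSet_Icc).mono fun s hs => hF_lip s hs _ _
  exact (hdiff.add h₀).congr (.of_forall fun s => sub_add_cancel _ _)

theorem ContinuousOn.integral_left {E : Type*} [NormedAddCommGroup E] [NormedSpace ℝ E]
    {a b : ℝ} (hab : a ≤ b) {u : ℝ → E} (hu : ContinuousOn u (Set.Icc a b)) :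
    ContinuousOn (fun s => ∫ ξ in s..b, u ξ) (Set.Icc a b) := by
  rw [← Set.uIcc_of_le hab] at hu ⊢
  exact intervalIntegral.continuousOn_primitive_interval_left (hu.integrableOn_compact isCompact_uIcc)

theorem integral_mul_exp_mul_sub (c s τ : ℝ) :
    ∫ ξ in s..τ, c * Real.exp (c * (τ - ξ)) = Real.exp (c * (τ - s)) - 1 := by
  have hd : ∀ ξ ∈ Set.uIcc s τ, HasDerivAt (fun ξ => -Real.exp (c * (τ - ξ)))
      (c * Real.exp (c * (τ - ξ))) ξ := by
    intro ξ _
    have := ((((hasDerivAt_id ξ).const_sub τ).const_mul c).exp).neg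
    exact this.congr_deriv (by simp only [id_eq]; ring)
  rw [intervalIntegral.integral_eq_sub_of_hasDerivAt hd
    (Continuous.intervalIntegrable (by fun_prop) _ _)]
  simp only [sub_self, mul_zero, Real.exp_zero]; ring

/-- A backward Grönwall inequality with an additional iterated integral: the memory term costs
one unit in the exponential rate. -/
theorem le_of_le_add_integral_exp_mul {τ l κ c δ : ℝ} (hτ : 0 ≤ τ) (hl : 0 ≤ l) (hκ : 0 ≤ κ)
    (hc : 1 + κ ≤ c) {w : ℝ → ℝ}
    (hw : ContinuousOn w (Set.Icc 0 τ)) (hw0 : ∀ t, 0 ≤ w t)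
    (h : ∀ t ∈ Set.Icc 0 τ, w t ≤ Real.exp (l * (τ - t)) * δ +
      ∫ s in t..τ, Real.exp (l * (s - t)) * (κ * w s + ∫ ξ in s..τ, w ξ)) :
    ∀ t ∈ Set.Icc 0 τ, w t ≤ δ * Real.exp (l * (τ - t)) * Real.exp (c * (τ - t)) := by
  set B : ℝ → ℝ := fun t => Real.exp (l * (τ - t)) * Real.exp (c * (τ - t)) with hB
  have hBpos : ∀ t, 0 < B t := fun t => by positivity
  have hBcont : Continuous B := by fun_prop
  have hBint : ∀ s ∈ Set.Icc 0 τ, ∫ ξ in s..τ, B ξ ≤ B s := by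
    intro s hs
    calc ∫ ξ in s..τ, B ξ ≤ ∫ ξ in s..τ, (l + c) * Real.exp ((l + c) * (τ - ξ)) := by
          refine intervalIntegral.integral_mono_on hs.2 (hBcont.intervalIntegrable _ _)
            (Continuous.intervalIntegrable (by fun_prop) _ _) fun ξ _ => ?_
          simp only [hB, ← Real.exp_add, ← add_mul]
          exact le_mul_of_one_le_left (Real.exp_pos _).le (by linarith)
      _ = B s - 1 := by
          rw [integral_mul_exp_mul_sub]; simp only [hB, ← Real.exp_add, ← add_mul]
      _ ≤ B s := by linarith
  obtain ⟨t₀, ht₀, hmax⟩ := isCompact_Icc.exists_isMaxOn (Set.nonempty_Icc.2 hτ)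
    (hw.div hBcont.continuousOn fun t _ => (hBpos t).ne')
  set M := w t₀ / B t₀ with hM
  have hM0 : 0 ≤ M := div_nonneg (hw0 _) (hBpos _).le
  have hwM : ∀ t ∈ Set.Icc 0 τ, w t ≤ M * B t := fun t ht =>
    (div_le_iff₀ (hBpos t)).1 (hmax ht)
  have hwint : ∀ s ∈ Set.Icc 0 τ, IntervalIntegrable w volume s τ := fun s hs =>
    (hw.mono (by rw [Set.uIcc_of_le hs.2]; exact Set.Icc_subset_Icc_left hs.1)).intervalIntegrable
  have hmem : ∀ s ∈ Set.Icc 0 τ, 0 ≤ ∫ ξ in s..τ, w ξ := fun s hs =>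
    intervalIntegral.integral_nonneg hs.2 fun ξ _ => hw0 ξ
  have hint : ∫ s in t₀..τ, Real.exp (l * (s - t₀)) * (κ * w s + ∫ ξ in s..τ, w ξ) ≤
      M * (B t₀ - Real.exp (l * (τ - t₀))) := by
    calc ∫ s in t₀..τ, Real.exp (l * (s - t₀)) * (κ * w s + ∫ ξ in s..τ, w ξ)
        ≤ ∫ s in t₀..τ, M * Real.exp (l * (τ - t₀)) * (c * Real.exp (c * (τ - s))) := by
          refine (Real.le_norm_self _).trans (intervalIntegral.norm_integral_le_of_norm_le ht₀.2
            (.of_forall fun s hs => ?_) ?_)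
          swap
          · exact Continuous.intervalIntegrable (by fun_prop) _ _
          have hs' : s ∈ Set.Icc 0 τ := ⟨ht₀.1.trans hs.1.le, hs.2⟩
          rw [Real.norm_of_nonneg
            (mul_nonneg (Real.exp_pos _).le (add_nonneg (mul_nonneg hκ (hw0 s)) (hmem s hs')))]
          have h1 : ∫ ξ in s..τ, w ξ ≤ M * B s := by
            calc ∫ ξ in s..τ, w ξ ≤ ∫ ξ in s..τ, M * B ξ :=
                  intervalIntegral.integral_mono_on hs'.2 (hwint s hs')
                    ((hBcont.const_mul M).intervalIntegrable _ _)
                    fun ξ hξ => hwM ξ ⟨hs'.1.trans hξ.1, hξ.2⟩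
              _ = M * ∫ ξ in s..τ, B ξ := intervalIntegral.integral_const_mul _ _
              _ ≤ M * B s := by gcongr; exact hBint s hs'
          have h2 : κ * w s + ∫ ξ in s..τ, w ξ ≤ c * (M * B s) := by
            have := mul_le_mul_of_nonneg_left (hwM s hs') hκ
            have := mul_le_mul_of_nonneg_right hc (mul_nonneg hM0 (hBpos s).le)
            linarith
          have h3 : Real.exp (l * (s - t₀)) * Real.exp (l * (τ - s)) =
              Real.exp (l * (τ - t₀)) := by
            rw [← Real.exp_add]; ring_nf
          calc Real.exp (l * (s - t₀)) * (κ * w s + ∫ ξ in s..τ, w ξ)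
              ≤ Real.exp (l * (s - t₀)) * (c * (M * B s)) := by gcongr
            _ = M * Real.exp (l * (τ - t₀)) * (c * Real.exp (c * (τ - s))) := by
                rw [← h3, hB]; ring
      _ = M * (B t₀ - Real.exp (l * (τ - t₀))) := by
          rw [intervalIntegral.integral_const_mul, integral_mul_exp_mul_sub, hB]; ring
  have hMδ : M ≤ δ := by
    have h4 := h t₀ ht₀
    have h5 : M * B t₀ = w t₀ := div_mul_cancel₀ _ (hBpos t₀).ne'
    refine le_of_mul_le_mul_left ?_ (Real.exp_pos (l * (τ - t₀)))
    linarith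
  intro t ht
  calc w t ≤ M * B t := hwM t ht
    _ ≤ δ * B t := mul_le_mul_of_nonneg_right hMδ (hBpos t).le
    _ = δ * Real.exp (l * (τ - t)) * Real.exp (c * (τ - t)) := by rw [hB]; ring

/-- Stability estimate: if `‖g − g^δ‖ ≤ δ` and `u^N`, `u^N_δ` are the fixed points of `𝔗`
with data `g` and `g^δ` respectively, then
`‖u^N(t) − u^N_δ(t)‖ ≤ δ e^{λ_N(τ−t)} e^{(1+κ₀)(τ−t)}` for all `t ∈ [0,τ]`. -/
theorem stability_estimate
    {H : Type*} [NormedAddCommGroup H] [InnerProductSpace ℝ H] [CompleteSpace H]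
    (τ : ℝ) (hτ : 0 < τ) (N : ℕ) (hN : 1 ≤ N)
    (φ : ℕ → H)
    (hφ : ∀ i ∈ Finset.Icc 1 N, ∀ j ∈ Finset.Icc 1 N,
      ⟪φ i, φ j⟫ = if i = j then (1:ℝ) else 0)
    (lam : ℕ → ℝ) (hlam_pos : 0 < lam 1)
    (hlam_mono : ∀ i j, 1 ≤ i → i ≤ j → j ≤ N → lam i ≤ lam j)
    (F : ℝ → H → H) (κ : ℝ) (hκ : 0 < κ)
    (hF_lip : ∀ s ∈ Set.Icc (0:ℝ) τ, ∀ ψ₁ ψ₂ : H, ‖F s ψ₁ - F s ψ₂‖ ≤ κ * ‖ψ₁ - ψ₂‖)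
    (hF_int : ∃ φ₀ : H, IntegrableOn (fun s => F s φ₀) (Set.Icc 0 τ))
    (hF_meas : ∀ w : ℝ → H, AEStronglyMeasurable w (volume.restrict (Set.Icc 0 τ)) →
      AEStronglyMeasurable (fun s => F s (w s)) (volume.restrict (Set.Icc 0 τ)))
    (κ₀ : ℝ) (hκ₀ : κ₀ = max κ 1)
    (δ : ℝ) (hδ : 0 < δ)
    (g gδ : H) (hgδ : ‖g - gδ‖ ≤ δ)
    (uN : ℝ → H) (huN_cont : ContinuousOn uN (Set.Icc 0 τ))
    (huN_fix : ∀ t ∈ Set.Icc (0:ℝ) τ,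
      uN t = (∑ j ∈ Finset.Icc 1 N, (Real.exp (lam j * (τ - t)) * ⟪g, φ j⟫) • φ j)
        - (∫ s in t..τ, ∑ j ∈ Finset.Icc 1 N,
            (Real.exp (lam j * (s - t)) * ⟪F s (uN s), φ j⟫) • φ j)
        - (∫ s in t..τ, ∑ j ∈ Finset.Icc 1 N,
            (Real.exp (lam j * (s - t)) * ⟪(∫ ξ in s..τ, uN ξ), φ j⟫) • φ j))
    (uNδ : ℝ → H) (huNδ_cont : ContinuousOn uNδ (Set.Icc 0 τ))
    (huNδ_fix : ∀ t ∈ Set.Icc (0:ℝ) τ,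
      uNδ t = (∑ j ∈ Finset.Icc 1 N, (Real.exp (lam j * (τ - t)) * ⟪gδ, φ j⟫) • φ j)
        - (∫ s in t..τ, ∑ j ∈ Finset.Icc 1 N,
            (Real.exp (lam j * (s - t)) * ⟪F s (uNδ s), φ j⟫) • φ j)
        - (∫ s in t..τ, ∑ j ∈ Finset.Icc 1 N,
            (Real.exp (lam j * (s - t)) * ⟪(∫ ξ in s..τ, uNδ ξ), φ j⟫) • φ j)) :
    ∀ t ∈ Set.Icc (0:ℝ) τ,
      ‖uN t - uNδ t‖ ≤ δ * Real.exp (lam N * (τ - t)) * Real.exp ((1 + κ₀) * (τ - t)) := by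
  have hlam : ∀ j ∈ Finset.Icc 1 N, lam j ≤ lam N := fun j hj =>
    hlam_mono j N (Finset.mem_Icc.1 hj).1 (Finset.mem_Icc.1 hj).2 le_rfl
  have hlN : 0 ≤ lam N := hlam_pos.le.trans (hlam_mono 1 N le_rfl hN le_rfl)
  have hsub : ∀ t ∈ Set.Icc 0 τ, Set.uIcc t τ ⊆ Set.Icc 0 τ := fun t ht => by
    rw [Set.uIcc_of_le ht.2]; exact Set.Icc_subset_Icc_left ht.1
  have hFi : ∀ u : ℝ → H, ContinuousOn u (Set.Icc 0 τ) → ∀ t ∈ Set.Icc 0 τ,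
      IntervalIntegrable (fun s => F s (u s)) volume t τ := fun u hu t ht =>
    ((integrableOn_comp_of_lipschitz hF_lip hF_int hF_meas hu).mono_set
      (hsub t ht)).intervalIntegrable
  have hui : ∀ u : ℝ → H, ContinuousOn u (Set.Icc 0 τ) → ∀ t ∈ Set.Icc 0 τ,
      IntervalIntegrable u volume t τ := fun u hu t ht =>
    (hu.mono (hsub t ht)).intervalIntegrable
  have hwc : ContinuousOn (fun s => ‖uN s - uNδ s‖) (Set.Icc 0 τ) := (huN_cont.sub huNδ_cont).norm
  refine le_of_le_add_integral_exp_mul hτ.le hlN hκ.le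
    (by rw [hκ₀]; gcongr; exact le_max_left _ _) hwc (fun _ => norm_nonneg _) ?_
  intro t ht
  let S := truncatedSemigroup φ lam N
  let D : ℝ → H := fun s => (F s (uN s) - F s (uNδ s)) + ∫ ξ in s..τ, (uN ξ - uNδ ξ)
  have hdiff : uN t - uNδ t = S (τ - t) (g - gδ) - ∫ s in t..τ, S (s - t) (D s) := by
    have hF₁ := truncatedSemigroup.intervalIntegrable (φ := φ) (lam := lam) (N := N)
      (hFi uN huN_cont t ht) t
    have hF₂ := truncatedSemigroup.intervalIntegrable (φ := φ) (lam := lam) (N := N)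
      (hFi uNδ huNδ_cont t ht) t
    have hm₁ := truncatedSemigroup.intervalIntegrable (φ := φ) (lam := lam) (N := N)
      (hui _ (huN_cont.integral_left hτ.le) t ht) t
    have hm₂ := truncatedSemigroup.intervalIntegrable (φ := φ) (lam := lam) (N := N)
      (hui _ (huNδ_cont.integral_left hτ.le) t ht) t
    have hD : ∫ s in t..τ, S (s - t) (D s) =
        ((∫ s in t..τ, S (s - t) (F s (uN s))) - ∫ s in t..τ, S (s - t) (F s (uNδ s))) +
        ((∫ s in t..τ, S (s - t) (∫ ξ in s..τ, uN ξ)) -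
          ∫ s in t..τ, S (s - t) (∫ ξ in s..τ, uNδ ξ)) := by
      rw [← intervalIntegral.integral_sub hF₁ hF₂, ← intervalIntegral.integral_sub hm₁ hm₂,
        ← intervalIntegral.integral_add (hF₁.sub hF₂) (hm₁.sub hm₂)]
      refine intervalIntegral.integral_congr fun s hs => ?_
      have hs' := hsub t ht hs
      simp only [S, D]
      rw [intervalIntegral.integral_sub (hui uN huN_cont s hs') (hui uNδ huNδ_cont s hs'),
        truncatedSemigroup.map_add, truncatedSemigroup.map_sub, truncatedSemigroup.map_sub]
    have e₁ : uN t = S (τ - t) g - (∫ s in t..τ, S (s - t) (F s (uN s))) -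
        ∫ s in t..τ, S (s - t) (∫ ξ in s..τ, uN ξ) := huN_fix t ht
    have e₂ : uNδ t = S (τ - t) gδ - (∫ s in t..τ, S (s - t) (F s (uNδ s))) -
        ∫ s in t..τ, S (s - t) (∫ ξ in s..τ, uNδ ξ) := huNδ_fix t ht
    have e₃ : S (τ - t) (g - gδ) = S (τ - t) g - S (τ - t) gδ :=
      truncatedSemigroup.map_sub _ _ _
    rw [hD, e₁, e₂, e₃]
    abel
  rw [hdiff]
  refine (norm_sub_le _ _).trans (add_le_add ?_ ?_)
  · refine (truncatedSemigroup.norm_le hφ hlam (sub_nonneg.2 ht.2) _).trans ?_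
    gcongr
  · refine intervalIntegral.norm_integral_le_of_norm_le ht.2 (.of_forall fun s hs => ?_) ?_
    · have hs' : s ∈ Set.Icc 0 τ := ⟨ht.1.trans hs.1.le, hs.2⟩
      refine (truncatedSemigroup.norm_le hφ hlam (sub_nonneg.2 hs.1.le) _).trans ?_
      gcongr
      exact (norm_add_le _ _).trans (add_le_add (hF_lip s hs' _ _)
        (intervalIntegral.norm_integral_le_integral_norm hs'.2))
    · refine ContinuousOn.intervalIntegrable (ContinuousOn.mono ?_ (hsub t ht))
      exact ContinuousOn.mul (by fun_prop) ((continuousOn_const.mul hwc).add (hwc.integral_left hτ.le))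
end
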